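/- Let $W$ be a finite group and let $R = \QQ[x_1,\dots,x_n]/(f_1,\dots,f_m)$ be the quotient of a finitely generated polynomial $\QQ$-algebra by an ideal generated by a regular sequence $(f_1,\dots,f_m)$. Let $A_\bullet$ be a $\QQ[W]$-CDGA whose homology is isomorphic to $R$ concentrated in degree zero with trivial $W$-action. Then $A_\bullet$ is formal as a $\QQ[W]$-CDGA. -/

import Mathlib

/-- A `ℤ`-graded commutative (in the graded sense) differential graded algebra
over `ℚ`: a `ℚ`-algebra with an internal `ℤ`-grading by `ℚ`-submodules, graded
commutativity with Koszul signs, and a degree `-1` differential satisfying the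
signed Leibniz rule. -/
structure CDGA where
  carrier : Type
  [ring : Ring carrier]
  [alg : Algebra ℚ carrier]
  grading : ℤ → Submodule ℚ carrier
  isInternal : DirectSum.IsInternal grading
  one_mem : (1 : carrier) ∈ grading 0
  mul_mem : ∀ {i j : ℤ} {x y : carrier},
    x ∈ grading i → y ∈ grading j → x * y ∈ grading (i + j)
  gcomm : ∀ {i j : ℤ} {x y : carrier}, x ∈ grading i → y ∈ grading j →
    x * y = ((-1 : ℚ) ^ (i * j)) • (y * x)
  d : carrier →ₗ[ℚ] carrier
  d_mem : ∀ {i : ℤ} {x : carrier}, x ∈ grading i → d x ∈ grading (i - 1)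
  d_d : ∀ x : carrier, d (d x) = 0
  leibniz : ∀ {i : ℤ} {x y : carrier}, x ∈ grading i →
    d (x * y) = d x * y + ((-1 : ℚ) ^ i) • (x * d y)

attribute [instance] CDGA.ring CDGA.alg

namespace CDGA

/-- `x` is a boundary in degree `k`, i.e. `x = d z` for some `z` of degree `k + 1`. -/
def IsBoundary (A : CDGA) (k : ℤ) (x : A.carrier) : Prop :=
  ∃ z ∈ A.grading (k + 1), A.d z = x

/-- A morphism of CDGAs: a `ℚ`-algebra homomorphism preserving the grading and
commuting with the differentials. -/
structure Hom (A B : CDGA) where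
  toFun : A.carrier →ₐ[ℚ] B.carrier
  map_grading : ∀ {i : ℤ} {x : A.carrier}, x ∈ A.grading i → toFun x ∈ B.grading i
  map_d : ∀ x : A.carrier, toFun (A.d x) = B.d (toFun x)

/-- A quasi-isomorphism of CDGAs: a morphism inducing an isomorphism on homology
in every degree. -/
def QuasiIso {A B : CDGA} (f : Hom A B) : Prop :=
  ∀ k : ℤ,
    (∀ y ∈ B.grading k, B.d y = 0 →
      ∃ x ∈ A.grading k, A.d x = 0 ∧ B.IsBoundary k (f.toFun x - y)) ∧
    (∀ x ∈ A.grading k, A.d x = 0 → B.IsBoundary k (f.toFun x) → A.IsBoundary k x)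

/-- `β^k` for `k : ℤ`, expressed via `β` and a chosen inverse `β'`. -/
def ipow {R : Type} [Ring R] (β β' : R) (k : ℤ) : R :=
  if 0 ≤ k then β ^ k.toNat else β' ^ (-k).toNat

/-- The homology of `A` is the Laurent algebra `ℚ[β^{±1}]`, `|β| = 2`, with `β` the
class of the cycle `β` (with chosen homology inverse `β'`): odd homology vanishes,
and the homology in degree `2k` is one-dimensional, spanned by the (nonzero) class
of `β^k`. -/
def HomologyIsLaurentOn (A : CDGA) (β β' : A.carrier) : Prop :=
  β ∈ A.grading 2 ∧ β' ∈ A.grading (-2) ∧ A.d β = 0 ∧ A.d β' = 0 ∧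
  A.IsBoundary 0 (β * β' - 1) ∧
  (∀ k : ℤ, ∀ x ∈ A.grading (2 * k + 1), A.d x = 0 → A.IsBoundary (2 * k + 1) x) ∧
  (∀ k : ℤ, ∀ x ∈ A.grading (2 * k), A.d x = 0 →
    ∃ c : ℚ, A.IsBoundary (2 * k) (x - c • ipow β β' k)) ∧
  (∀ k : ℤ, ¬ A.IsBoundary (2 * k) (ipow β β' k))

end CDGA

namespace CDGA

/-- Evaluation of a multivariate polynomial over `ℚ` at a family of elements of a
(possibly noncommutative) `ℚ`-algebra, multiplying the variables in order.  When
the elements pairwise commute (e.g. elements of degree `0` in a CDGA) this is the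
usual evaluation of polynomials. -/
noncomputable def mvEval {R : Type} [Ring R] [Algebra ℚ R] {N : ℕ}
    (a : Fin N → R) (p : MvPolynomial (Fin N) ℚ) : R :=
  ∑ α ∈ p.support, (MvPolynomial.coeff α p) •
    (((List.finRange N).map fun i => a i ^ α i).prod)

end CDGA

open CDGA

/-- `f₁, …, f_m` is a regular sequence in `ℚ[x₁,…,x_N]`: each `f_i` is a
nonzerodivisor modulo its predecessors, and the quotient is nonzero. -/
def IsRegularSeq {N m : ℕ} (f : Fin m → MvPolynomial (Fin N) ℚ) : Prop :=
  Ideal.span (Set.range f) ≠ ⊤ ∧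
  ∀ (i : Fin m) (p : MvPolynomial (Fin N) ℚ),
    f i * p ∈ Ideal.span (f '' {j | j < i}) → p ∈ Ideal.span (f '' {j | j < i})

namespace CDGA

noncomputable instance (A : CDGA) : DirectSum.Decomposition A.grading :=
  A.isInternal.chooseDecomposition

noncomputable instance (A : CDGA) : GradedAlgebra A.grading where
  one_mem := A.one_mem
  mul_mem _ _ _ _ hx hy := A.mul_mem hx hy

/-- The homogeneous component of degree `k`, as a linear endomorphism. -/
noncomputable def component (A : CDGA) (k : ℤ) : A.carrier →ₗ[ℚ] A.carrier :=
  GradedAlgebra.proj A.grading k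

lemma component_apply (A : CDGA) (k : ℤ) (x : A.carrier) :
    A.component k x = (DirectSum.decompose A.grading x k : A.carrier) :=
  GradedAlgebra.proj_apply A.grading k x

lemma component_mem (A : CDGA) (k : ℤ) (x : A.carrier) : A.component k x ∈ A.grading k := by
  rw [component_apply]
  exact SetLike.coe_mem _

lemma component_of_mem {A : CDGA} {k : ℤ} {x : A.carrier} (hx : x ∈ A.grading k) :
    A.component k x = x := by
  rw [component_apply]
  exact DirectSum.decompose_of_mem_same A.grading hx

lemma component_of_mem_ne {A : CDGA} {i k : ℤ} {x : A.carrier} (hx : x ∈ A.grading i)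
    (h : i ≠ k) : A.component k x = 0 := by
  rw [component_apply]
  exact DirectSum.decompose_of_mem_ne A.grading hx h

open scoped Classical in
lemma sum_component (A : CDGA) (x : A.carrier) :
    ∑ k ∈ (DirectSum.decompose A.grading x).support, A.component k x = x := by
  simpa only [component_apply] using DirectSum.sum_support_decompose A.grading x

open scoped Classical in
lemma component_mul (A : CDGA) (k : ℤ) (x y : A.carrier) :
    A.component k (x * y) =
      ∑ ij ∈ (DirectSum.decompose A.grading x).support ×ˢ
          (DirectSum.decompose A.grading y).support with ij.1 + ij.2 = k,
        A.component ij.1 x * A.component ij.2 y := by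
  simp only [component_apply]
  rw [DirectSum.decompose_mul, DirectSum.coe_mul_apply]

/-- A linear map which is homogeneous of degree `s` commutes with taking components. -/
lemma component_map {A B : CDGA} (f : A.carrier →ₗ[ℚ] B.carrier) (s : ℤ)
    (hf : ∀ i, ∀ x ∈ A.grading i, f x ∈ B.grading (i + s)) (k : ℤ) (x : A.carrier) :
    B.component (k + s) (f x) = f (A.component k x) := by
  induction x using DirectSum.Decomposition.inductionOn A.grading with
  | zero => simp
  | @homogeneous i m =>
    by_cases h : i = k
    · subst h
      rw [component_of_mem m.2, component_of_mem (hf _ _ m.2)]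
    · rw [component_of_mem_ne m.2 h, component_of_mem_ne (hf _ _ m.2) (by omega), map_zero]
  | add x y hx hy => simp only [map_add, hx, hy]

lemma component_d (A : CDGA) (k : ℤ) (x : A.carrier) :
    A.component k (A.d x) = A.d (A.component (k + 1) x) := by
  have := component_map A.d (-1) (fun i x hx => A.d_mem hx) (k + 1) x
  simpa using this

lemma commute_of_mem_zero {A : CDGA} {x y : A.carrier} (hx : x ∈ A.grading 0)
    (hy : y ∈ A.grading 0) : x * y = y * x := by
  simpa using A.gcomm hx hy

lemma d_one (A : CDGA) : A.d 1 = 0 := by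
  have h := A.leibniz (y := 1) A.one_mem
  simpa using h

lemma d_algebraMap (A : CDGA) (r : ℚ) : A.d (algebraMap ℚ A.carrier r) = 0 := by
  rw [Algebra.algebraMap_eq_smul_one, map_smul, d_one, smul_zero]

lemma algebraMap_mem_zero (A : CDGA) (r : ℚ) : algebraMap ℚ A.carrier r ∈ A.grading 0 := by
  rw [Algebra.algebraMap_eq_smul_one]
  exact (A.grading 0).smul_mem r A.one_mem

lemma d_mul_of_mem_zero {A : CDGA} {x : A.carrier} (hx : x ∈ A.grading 0) (y : A.carrier) :
    A.d (x * y) = A.d x * y + x * A.d y := by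
  simpa using A.leibniz (y := y) hx

/-- The boundaries of degree `k`, as a submodule. -/
def boundaries (A : CDGA) (k : ℤ) : Submodule ℚ A.carrier :=
  (A.grading (k + 1)).map A.d

/-- A differential graded subalgebra, given by a subalgebra closed under taking homogeneous
components and under the differential. -/
noncomputable def ofSubalgebra (A : CDGA) (S : Subalgebra ℚ A.carrier)
    (hS : ∀ x ∈ S, ∀ k, A.component k x ∈ S) (hd : ∀ x ∈ S, A.d x ∈ S) : CDGA where
  carrier := S
  grading k := (A.grading k).comap S.val.toLinearMap
  isInternal := by
    rw [DirectSum.isInternal_submodule_iff_iSupIndep_and_iSup_eq_top]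
    constructor
    · rw [iSupIndep_def]
      intro i
      rw [Submodule.disjoint_def]
      intro x hx hx'
      have hle : (⨆ (j) (_ : j ≠ i), (A.grading j).comap S.val.toLinearMap) ≤
          (⨆ (j) (_ : j ≠ i), A.grading j).comap S.val.toLinearMap :=
        iSup₂_le fun j hj => Submodule.comap_mono (le_iSup₂_of_le j hj le_rfl)
      have h0 := Submodule.disjoint_def.1
        ((iSupIndep_def.1 A.isInternal.submodule_iSupIndep) i) _ hx (hle hx')
      exact Subtype.ext h0
    · rw [eq_top_iff]
      rintro x -
      classical
      have hx : x = ∑ k ∈ (DirectSum.decompose A.grading (x : A.carrier)).support,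
          (⟨A.component k x, hS x x.2 k⟩ : S) := by
        apply Subtype.ext
        rw [AddSubmonoidClass.coe_finsetSum]
        exact (A.sum_component x).symm
      rw [hx]
      exact Submodule.sum_mem _ fun k _ => Submodule.mem_iSup_of_mem k (A.component_mem k x)
  one_mem := A.one_mem
  mul_mem hx hy := A.mul_mem hx hy
  gcomm hx hy := Subtype.ext (A.gcomm hx hy)
  d := A.d.restrict (p := Subalgebra.toSubmodule S) (q := Subalgebra.toSubmodule S) hd
  d_mem hx := A.d_mem hx
  d_d x := Subtype.ext (A.d_d x)
  leibniz hx := Subtype.ext (A.leibniz hx)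

/-- A commutative algebra, viewed as a CDGA concentrated in degree `0`. -/
def ofCommAlgebra (R : Type) [CommRing R] [Algebra ℚ R] : CDGA where
  carrier := R
  grading k := if k = 0 then ⊤ else ⊥
  isInternal := by
    rw [DirectSum.isInternal_submodule_iff_iSupIndep_and_iSup_eq_top]
    constructor
    · rw [iSupIndep_def]
      intro i
      by_cases hi : i = 0
      · have : (⨆ (j) (_ : j ≠ i), (if j = 0 then ⊤ else ⊥ : Submodule ℚ R)) = ⊥ := by
          simp only [iSup_eq_bot]
          intro j hj
          rw [if_neg (by omega)]
        rw [this]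
        exact disjoint_bot_right
      · rw [if_neg hi]
        exact disjoint_bot_left
    · exact eq_top_iff.2 (le_iSup_of_le 0 (by simp))
  one_mem := by simp
  mul_mem {i j x y} hx hy := by
    by_cases hi : i = 0 <;> by_cases hj : j = 0 <;> simp_all
  gcomm {i j x y} hx hy := by
    by_cases hi : i = 0 <;> by_cases hj : j = 0 <;> simp_all [mul_comm]
  d := 0
  d_mem _ := by simp
  d_d _ := rfl
  leibniz _ := by simp

/-- An algebra homomorphism to a commutative algebra which vanishes on boundaries and outside of
degree `0`, as a morphism of CDGAs. -/
def Hom.toCommAlgebra {D : CDGA} {R : Type} [CommRing R] [Algebra ℚ R] (φ : D.carrier →ₐ[ℚ] R)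
    (hφ : ∀ k ≠ 0, ∀ x ∈ D.grading k, φ x = 0) (hφd : ∀ x, φ (D.d x) = 0) :
    Hom D (ofCommAlgebra R) where
  toFun := φ
  map_grading {i x} hx := by
    change φ x ∈ (if i = 0 then ⊤ else ⊥ : Submodule ℚ R)
    by_cases hi : i = 0
    · simp [hi]
    · simp [hi, hφ i hi x hx]
  map_d := hφd

lemma quasiIso_toCommAlgebra {D : CDGA} {R : Type} [CommRing R] [Algebra ℚ R]
    (φ : D.carrier →ₐ[ℚ] R) (hφ : ∀ k ≠ 0, ∀ x ∈ D.grading k, φ x = 0)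
    (hφd : ∀ x, φ (D.d x) = 0) (hconc : ∀ k ≠ 0, ∀ x ∈ D.grading k, D.d x = 0 → D.IsBoundary k x)
    (hsurj : ∀ y, ∃ x ∈ D.grading 0, D.d x = 0 ∧ φ x = y)
    (hinj : ∀ x ∈ D.grading 0, D.d x = 0 → φ x = 0 → D.IsBoundary 0 x) :
    QuasiIso (Hom.toCommAlgebra φ hφ hφd) := by
  intro k
  rcases eq_or_ne k 0 with rfl | hk
  · refine ⟨fun y _ _ => ?_, fun x hx hdx hb => hinj x hx hdx ?_⟩
    · obtain ⟨x, hx, hdx, hxy⟩ := hsurj y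
      exact ⟨x, hx, hdx, 0, zero_mem _, (sub_eq_zero.2 hxy).symm⟩
    · obtain ⟨z, -, hz⟩ := hb
      exact hz.symm
  · refine ⟨fun y hy _ => ⟨0, zero_mem _, map_zero _, 0, zero_mem _, ?_⟩,
      fun x hx hdx _ => hconc k hk x hx hdx⟩
    have hy0 : y = 0 := by
      change y ∈ (if k = 0 then ⊤ else ⊥ : Submodule ℚ R) at hy
      rw [if_neg hk] at hy
      exact hy
    rw [hy0, map_zero, map_zero, sub_zero]

/-- The cycles of degree `0`. -/
def zeroCycles (A : CDGA) : Subalgebra ℚ A.carrier where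
  carrier := {x | x ∈ A.grading 0 ∧ A.d x = 0}
  mul_mem' {x y} hx hy := ⟨by simpa using A.mul_mem hx.1 hy.1, by
    rw [d_mul_of_mem_zero hx.1, hx.2, hy.2, zero_mul, mul_zero, add_zero]⟩
  add_mem' {x y} hx hy := ⟨add_mem hx.1 hy.1, by rw [map_add, hx.2, hy.2, add_zero]⟩
  algebraMap_mem' r := ⟨A.algebraMap_mem_zero r, A.d_algebraMap r⟩

instance (A : CDGA) : CommRing A.zeroCycles where
  mul_comm x y := Subtype.ext (commute_of_mem_zero x.2.1 y.2.1)

/-- The boundaries of degree `0`, as an ideal in the cycles of degree `0`. -/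
def zeroBoundaries (A : CDGA) : Ideal A.zeroCycles where
  carrier := {x | A.IsBoundary 0 (x : A.carrier)}
  zero_mem' := (A.boundaries 0).zero_mem
  add_mem' hx hy := (A.boundaries 0).add_mem hx hy
  smul_mem' := by
    rintro x y ⟨z, hz, hzy⟩
    refine ⟨x * z, by simpa using A.mul_mem x.2.1 hz, ?_⟩
    rw [d_mul_of_mem_zero x.2.1, x.2.2, zero_mul, zero_add, hzy]
    rfl

lemma mem_zeroBoundaries {A : CDGA} {x : A.zeroCycles} :
    x ∈ A.zeroBoundaries ↔ A.IsBoundary 0 (x : A.carrier) := Iff.rfl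

/-- The homology algebra in degree `0`. -/
abbrev zeroHomology (A : CDGA) : Type := A.zeroCycles ⧸ A.zeroBoundaries

/-- In nonnegatively graded elements, the component of degree `0` is multiplicative. -/
lemma component_zero_mul {A : CDGA} {x y : A.carrier} (hx : ∀ k < 0, A.component k x = 0)
    (hy : ∀ k < 0, A.component k y = 0) :
    A.component 0 (x * y) = A.component 0 x * A.component 0 y := by
  classical
  have hsum : ∀ z : A.carrier, (∀ k < 0, A.component k z = 0) →
      ∀ k ∈ (DirectSum.decompose A.grading z).support, 0 ≤ k := by
    intro z hz k hk
    by_contra! h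
    rw [DFinsupp.mem_support_iff] at hk
    apply hk
    apply Subtype.ext
    rw [← component_apply, hz k h]
    rfl
  have hnot : ∀ z : A.carrier, 0 ∉ (DirectSum.decompose A.grading z).support →
      A.component 0 z = 0 := by
    intro z hz
    rw [DFinsupp.notMem_support_iff] at hz
    rw [component_apply, hz]
    rfl
  rw [component_mul, Finset.sum_eq_single (0, 0)]
  · rintro ⟨i, j⟩ hij hne
    simp only [Finset.mem_filter, Finset.mem_product] at hij
    have hi := hsum x hx i hij.1.1
    have hj := hsum y hy j hij.1.2
    exact absurd (Prod.ext (by omega) (by omega)) hne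
  · intro h
    simp only [Finset.mem_filter, Finset.mem_product, add_zero, and_true, not_and_or] at h
    rcases h with h | h
    · rw [hnot x h, zero_mul]
    · rw [hnot y h, mul_zero]

lemma component_mul_of_neg {A : CDGA} {x y : A.carrier} (hx : ∀ k < 0, A.component k x = 0)
    (hy : ∀ k < 0, A.component k y = 0) {k : ℤ} (hk : k < 0) :
    A.component k (x * y) = 0 := by
  rw [component_mul]
  refine Finset.sum_eq_zero fun ij hij => ?_
  have hsum := (Finset.mem_filter.1 hij).2
  by_cases h : ij.1 < 0
  · rw [hx _ h, zero_mul]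
  · rw [hy ij.2 (by omega), mul_zero]

/-- The connective cover: elements without components of negative degree, whose component of
degree `0` is a cycle. -/
noncomputable def connective (A : CDGA) : Subalgebra ℚ A.carrier where
  carrier := {x | (∀ k < 0, A.component k x = 0) ∧ A.d (A.component 0 x) = 0}
  mul_mem' {x y} hx hy := ⟨fun k hk => component_mul_of_neg hx.1 hy.1 hk, by
    rw [component_zero_mul hx.1 hy.1, d_mul_of_mem_zero (A.component_mem 0 x), hx.2, hy.2,
      zero_mul, mul_zero, add_zero]⟩
  add_mem' {x y} hx hy := ⟨fun k hk => by rw [map_add, hx.1 k hk, hy.1 k hk, add_zero], by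
    rw [map_add, map_add, hx.2, hy.2, add_zero]⟩
  algebraMap_mem' r := ⟨fun k hk =>
    component_of_mem_ne (A.algebraMap_mem_zero r) hk.ne', by
      rw [component_of_mem (A.algebraMap_mem_zero r), d_algebraMap]⟩

lemma mem_connective_of_pos {A : CDGA} {k : ℤ} (hk : 0 < k) {x : A.carrier}
    (hx : x ∈ A.grading k) : x ∈ A.connective :=
  ⟨fun i hi => component_of_mem_ne hx (by omega), by
    rw [component_of_mem_ne hx hk.ne', map_zero]⟩

lemma mem_connective_of_mem_zeroCycles {A : CDGA} {x : A.carrier} (hx : x ∈ A.zeroCycles) :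
    x ∈ A.connective :=
  ⟨fun i hi => component_of_mem_ne hx.1 (by omega), by rw [component_of_mem hx.1, hx.2]⟩

lemma eq_zero_of_mem_connective {A : CDGA} {k : ℤ} (hk : k < 0) {x : A.carrier}
    (hx : x ∈ A.connective) (hxk : x ∈ A.grading k) : x = 0 := by
  rw [← component_of_mem hxk, hx.1 k hk]

lemma component_mem_connective {A : CDGA} {x : A.carrier} (hx : x ∈ A.connective) (k : ℤ) :
    A.component k x ∈ A.connective := by
  rcases lt_trichotomy k 0 with hk | rfl | hk
  · rw [hx.1 k hk]
    exact zero_mem _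
  · exact mem_connective_of_mem_zeroCycles ⟨A.component_mem 0 x, hx.2⟩
  · exact mem_connective_of_pos hk (A.component_mem k x)

lemma d_mem_connective {A : CDGA} {x : A.carrier} (hx : x ∈ A.connective) :
    A.d x ∈ A.connective := by
  refine ⟨fun k hk => ?_, by rw [component_d, d_d]⟩
  rw [component_d]
  rcases (show k + 1 ≤ 0 by omega).lt_or_eq with h | h
  · rw [hx.1 _ h, map_zero]
  · rw [h, hx.2]

/-- The projection of the connective cover onto its degree `0` part. -/
noncomputable def connectiveToZeroCycles (A : CDGA) : A.connective →ₐ[ℚ] A.zeroCycles :=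
  AlgHom.ofLinearMap
    ((A.component 0).restrict (p := Subalgebra.toSubmodule A.connective)
      (q := Subalgebra.toSubmodule A.zeroCycles) fun x hx => ⟨A.component_mem 0 x, hx.2⟩)
    (Subtype.ext (component_of_mem A.one_mem))
    fun x y => Subtype.ext (component_zero_mul x.2.1 y.2.1)

/-- On commuting elements, `mvEval` is the usual evaluation of polynomials. -/
lemma mvEval_eq_aeval {A : CDGA} {N : ℕ} (b : Fin N → A.zeroCycles)
    (p : MvPolynomial (Fin N) ℚ) :
    mvEval (fun i => (b i : A.carrier)) p = (MvPolynomial.aeval b p : A.zeroCycles) := by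
  rw [MvPolynomial.aeval_def, MvPolynomial.eval₂_eq', AddSubmonoidClass.coe_finsetSum, mvEval]
  refine Finset.sum_congr rfl fun α _ => ?_
  rw [← Algebra.smul_def, ← List.prod_ofFn, List.ofFn_eq_map]
  change _ = MvPolynomial.coeff α p • A.zeroCycles.val _
  rw [map_list_prod, List.map_map]
  rfl

/-- If the classes of `a` generate `H₀` with ideal of relations `I`, then `H₀` is the quotient of
the polynomial algebra by `I`. -/
lemma nonempty_zeroHomology_algEquiv {A : CDGA} {N : ℕ} (I : Ideal (MvPolynomial (Fin N) ℚ))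
    (a : Fin N → A.carrier) (ha : ∀ i, a i ∈ A.grading 0 ∧ A.d (a i) = 0)
    (hsurj : ∀ x ∈ A.grading 0, A.d x = 0 →
      ∃ p : MvPolynomial (Fin N) ℚ, A.IsBoundary 0 (x - mvEval a p))
    (hker : ∀ p : MvPolynomial (Fin N) ℚ, A.IsBoundary 0 (mvEval a p) ↔ p ∈ I) :
    Nonempty (A.zeroHomology ≃ₐ[ℚ] (MvPolynomial (Fin N) ℚ ⧸ I)) := by
  let b : Fin N → A.zeroCycles := fun i => ⟨a i, ha i⟩
  have hb : ∀ p, mvEval a p = (MvPolynomial.aeval b p : A.zeroCycles) := mvEval_eq_aeval b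
  let ψ : MvPolynomial (Fin N) ℚ →ₐ[ℚ] A.zeroHomology :=
    (Ideal.Quotient.mkₐ ℚ A.zeroBoundaries).comp (MvPolynomial.aeval b)
  have hψ : Function.Surjective ψ := by
    intro y
    obtain ⟨x, rfl⟩ := Ideal.Quotient.mk_surjective y
    obtain ⟨p, hp⟩ := hsurj x x.2.1 x.2.2
    refine ⟨p, Eq.symm ((Ideal.Quotient.eq).2 ?_)⟩
    rw [hb] at hp
    exact hp
  have hI : RingHom.ker ψ = I := by
    ext p
    rw [RingHom.mem_ker, ← hker, hb]
    exact Ideal.Quotient.eq_zero_iff_mem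
  exact ⟨(Ideal.quotientKerAlgEquivOfSurjective hψ).symm.trans
    (Ideal.quotientEquivAlgOfEq ℚ hI)⟩

section Action

variable {W : Type} [Group W] {A : CDGA} (ρ : W →* (A.carrier ≃ₐ[ℚ] A.carrier))

/-- The subalgebra of invariants of an action by algebra automorphisms. -/
def invariants : Subalgebra ℚ A.carrier where
  carrier := {x | ∀ w, ρ w x = x}
  mul_mem' hx hy w := by rw [map_mul, hx w, hy w]
  add_mem' hx hy w := by rw [map_add, hx w, hy w]
  algebraMap_mem' r w := (ρ w).commutes r

/-- The average of an element over a finite group of automorphisms. -/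
noncomputable def average [Fintype W] (x : A.carrier) : A.carrier :=
  (Fintype.card W : ℚ)⁻¹ • ∑ w, ρ w x

variable [Fintype W]

lemma average_mem_invariants (x : A.carrier) : average ρ x ∈ invariants ρ := by
  intro v
  rw [average, map_smul, map_sum]
  congr 1
  exact Fintype.sum_equiv (Equiv.mulLeft v) _ _ fun w => by simp [AlgEquiv.mul_apply]

lemma average_sub_self (x : A.carrier) :
    average ρ x - x = (Fintype.card W : ℚ)⁻¹ • ∑ w, (ρ w x - x) := by
  have hW : (Fintype.card W : ℚ) ≠ 0 := Nat.cast_ne_zero.2 Fintype.card_ne_zero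
  rw [average, Finset.sum_sub_distrib, smul_sub, Finset.sum_const, Finset.card_univ,
    ← Nat.cast_smul_eq_nsmul ℚ, smul_smul, inv_mul_cancel₀ hW, one_smul]

lemma average_of_mem_invariants {x : A.carrier} (hx : x ∈ invariants ρ) : average ρ x = x := by
  rw [← sub_eq_zero, average_sub_self, Finset.sum_eq_zero fun w _ => sub_eq_zero.2 (hx w),
    smul_zero]

lemma average_mem {k : ℤ} (hρ : ∀ w, ∀ x ∈ A.grading k, ρ w x ∈ A.grading k) {x : A.carrier}
    (hx : x ∈ A.grading k) : average ρ x ∈ A.grading k :=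
  Submodule.smul_mem _ _ (Submodule.sum_mem _ fun w _ => hρ w x hx)

lemma d_average (hρd : ∀ (w : W) (x : A.carrier), ρ w (A.d x) = A.d (ρ w x)) (x : A.carrier) :
    A.d (average ρ x) = average ρ (A.d x) := by
  simp only [average, map_smul, map_sum, hρd]

end Action

/-- The invariants in the connective cover. -/
noncomputable def connectiveInvariants {W : Type} [Group W] {A : CDGA}
    (ρ : W →* (A.carrier ≃ₐ[ℚ] A.carrier))
    (hρd : ∀ (w : W) (x : A.carrier), ρ w (A.d x) = A.d (ρ w x))
    (hρg : ∀ (w : W) (i : ℤ), ∀ x ∈ A.grading i, ρ w x ∈ A.grading i) : CDGA :=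
  A.ofSubalgebra (A.connective ⊓ invariants ρ)
    (fun x hx k => ⟨component_mem_connective hx.1 k, fun w => by
      have h := component_map (ρ w).toLinearMap 0
        (fun i y hy => by simpa using hρg w i y hy) k x
      rw [add_zero] at h
      exact h.symm.trans (congrArg _ (hx.2 w))⟩)
    fun x hx => ⟨d_mem_connective hx.1, fun w => by rw [hρd, hx.2 w]⟩

end CDGA

/-- let `W` be a finite group and `R = ℚ[x₁,…,x_N]/(f₁,…,f_m)` the
quotient of a polynomial algebra by a regular sequence.  Any `ℚ[W]`-CDGA `A` whose
homology is `R` concentrated in degree `0` with trivial `W`-action is formal as a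
`ℚ[W]`-CDGA: there is a zig-zag of `W`-equivariant quasi-isomorphisms `A ← D → L`
with `D`, `L` carrying the trivial `W`-action, where `L` has zero differential, is
concentrated in degree `0`, and its algebra is `R`. -/
theorem regular_quotient_homology_equivariantly_formal
    (W : Type) [Group W] [Finite W] (N m : ℕ)
    (F : Fin m → MvPolynomial (Fin N) ℚ) (hreg : IsRegularSeq F)
    (A : CDGA) (ρ : W →* (A.carrier ≃ₐ[ℚ] A.carrier))
    (hρd : ∀ (w : W) (x : A.carrier), ρ w (A.d x) = A.d (ρ w x))
    (hρg : ∀ (w : W) (i : ℤ), ∀ x ∈ A.grading i, ρ w x ∈ A.grading i)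
    -- homology is R concentrated in degree 0 …
    (a : Fin N → A.carrier) (ha : ∀ i, a i ∈ A.grading 0 ∧ A.d (a i) = 0)
    (hsurj : ∀ x ∈ A.grading 0, A.d x = 0 →
      ∃ p : MvPolynomial (Fin N) ℚ, A.IsBoundary 0 (x - mvEval a p))
    (hker : ∀ p : MvPolynomial (Fin N) ℚ,
      A.IsBoundary 0 (mvEval a p) ↔ p ∈ Ideal.span (Set.range F))
    (hconc : ∀ k : ℤ, k ≠ 0 → ∀ x ∈ A.grading k, A.d x = 0 → A.IsBoundary k x)
    -- … with trivial W-action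
    (htriv : ∀ (w : W) (k : ℤ), ∀ x ∈ A.grading k, A.d x = 0 →
      A.IsBoundary k ((ρ w) x - x)) :
    ∃ (D L : CDGA) (f : Hom D A) (g : Hom D L), QuasiIso f ∧ QuasiIso g ∧
      (∀ (w : W) (x : D.carrier), ρ w (f.toFun x) = f.toFun x) ∧
      L.d = 0 ∧ (∀ k : ℤ, k ≠ 0 → L.grading k = ⊥) ∧
      Nonempty (L.carrier ≃ₐ[ℚ]
        (MvPolynomial (Fin N) ℚ ⧸ Ideal.span (Set.range F))) := by
  have := Fintype.ofFinite W
  let D := connectiveInvariants ρ hρd hρg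
  let f : Hom D A :=
    { toFun := (A.connective ⊓ invariants ρ).val
      map_grading := fun hx => hx
      map_d := fun _ => rfl }
  let g₀ : D.carrier →ₐ[ℚ] A.zeroCycles :=
    A.connectiveToZeroCycles.comp (Subalgebra.inclusion inf_le_left)
  have hg₀ : ∀ x : D.carrier, (g₀ x : A.carrier) = A.component 0 (f.toFun x) := fun _ => rfl
  have hφd : ∀ x : D.carrier, Ideal.Quotient.mk A.zeroBoundaries (g₀ (D.d x)) = 0 := by
    intro x
    rw [Ideal.Quotient.eq_zero_iff_mem, mem_zeroBoundaries, hg₀, f.map_d, component_d]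
    exact ⟨_, A.component_mem _ _, rfl⟩
  let φ : D.carrier →ₐ[ℚ] A.zeroHomology := (Ideal.Quotient.mkₐ ℚ A.zeroBoundaries).comp g₀
  have hφk : ∀ k ≠ 0, ∀ x ∈ D.grading k, φ x = 0 := by
    intro k hk x hx
    have h0 : g₀ x = 0 := Subtype.ext (component_of_mem_ne hx hk)
    rw [AlgHom.comp_apply, h0, map_zero]
  have hbd : ∀ k : ℤ, ∀ x ∈ D.grading k, A.IsBoundary k (f.toFun x) → D.IsBoundary k x := by
    rintro k x hx ⟨z, hz, hzx⟩
    by_cases hk : k < 0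
    · have h0 : x = 0 := Subtype.ext (eq_zero_of_mem_connective hk x.2.1 hx)
      rw [h0]
      exact (D.boundaries k).zero_mem
    · have hz' := average_mem ρ (fun w => hρg w _) hz
      refine ⟨⟨average ρ z, mem_connective_of_pos (by omega) hz', average_mem_invariants ρ z⟩,
        hz', Subtype.ext ?_⟩
      change A.d (average ρ z) = x.1
      rw [d_average ρ hρd, hzx]
      exact average_of_mem_invariants ρ x.2.2
  have hlift : ∀ y ∈ A.grading 0, A.d y = 0 →
      ∃ x ∈ D.grading 0, D.d x = 0 ∧ A.IsBoundary 0 (f.toFun x - y) := by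
    intro y hy hdy
    have h0 : average ρ y ∈ A.grading 0 := average_mem ρ (fun w => hρg w _) hy
    have hd0 : A.d (average ρ y) = 0 := by
      rw [d_average ρ hρd, hdy]
      exact average_of_mem_invariants ρ (zero_mem _)
    refine ⟨⟨average ρ y, mem_connective_of_mem_zeroCycles ⟨h0, hd0⟩,
      average_mem_invariants ρ y⟩, h0, Subtype.ext hd0, ?_⟩
    change A.IsBoundary 0 (average ρ y - y)
    rw [average_sub_self]
    exact (A.boundaries 0).smul_mem _
      (Submodule.sum_mem _ fun w _ => htriv w 0 y hy hdy)
  refine ⟨D, ofCommAlgebra A.zeroHomology, f, Hom.toCommAlgebra φ hφk hφd,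
    fun k => ⟨fun y hy hdy => ?_, fun x hx _ => hbd k x hx⟩,
    quasiIso_toCommAlgebra φ hφk hφd (fun k hk x hx hdx => hbd k x hx (hconc k hk _ hx ?_))
      (fun y => ?_) fun x hx hdx hφx => hbd 0 x hx ?_,
    fun w x => x.2.2 w, rfl, fun k hk => if_neg hk,
    nonempty_zeroHomology_algEquiv _ a ha hsurj hker⟩
  · by_cases hk : k = 0
    · subst hk
      exact hlift y hy hdy
    · refine ⟨0, zero_mem _, map_zero _, ?_⟩
      rw [map_zero, zero_sub]
      exact (A.boundaries k).neg_mem (hconc k hk y hy hdy)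
  · rw [← f.map_d, hdx, map_zero]
  · obtain ⟨c, rfl⟩ := Ideal.Quotient.mk_surjective y
    obtain ⟨x, hx, hdx, hxc⟩ := hlift c c.2.1 c.2.2
    refine ⟨x, hx, hdx, (Ideal.Quotient.eq).2 ?_⟩
    change A.IsBoundary 0 (A.component 0 (f.toFun x) - c)
    rw [component_of_mem (f.map_grading hx)]
    exact hxc
  · have h : A.IsBoundary 0 (A.component 0 (f.toFun x)) := (Ideal.Quotient.eq_zero_iff_mem).1 hφx
    rwa [component_of_mem (f.map_grading hx)] at h
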